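/- There exists no strictly 𝓕₀-consistent scoring function for the mode; that is, the mode is not elicitable relative to the class 𝓕₀ of strictly unimodal distributions with continuous Lebesgue density. -/

import Mathlib

open MeasureTheory Set Filter

/-- `f` belongs to `𝓕₀` with mode `x₀`: continuous, nonnegative, integrates to 1,
nondecreasing on `(-∞, x₀]`, nonincreasing on `[x₀, ∞)`, and `x₀` is the unique
local (hence global) maximum. -/
def IsUnimodalDensity (f : ℝ → ℝ) (x₀ : ℝ) : Prop :=
  Continuous f ∧ (∀ y, 0 ≤ f y) ∧ (∫ y : ℝ, f y) = 1 ∧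
    MonotoneOn f (Set.Iic x₀) ∧ AntitoneOn f (Set.Ici x₀) ∧
    ∀ x, x ≠ x₀ → f x < f x₀

/-- `f` belongs to the class `𝓕₀` of strictly unimodal distributions with
continuous Lebesgue density. -/
def MemF0 (f : ℝ → ℝ) : Prop := ∃ x₀, IsUnimodalDensity f x₀

/-- `s` is a strictly `𝓕₀`-consistent scoring function for the mode. -/
def StrictlyF0Consistent (s : ℝ × ℝ → ℝ) : Prop :=
  Measurable s ∧
  (∀ x : ℝ, ∀ f : ℝ → ℝ, MemF0 f → Integrable (fun y => |s (x, y)| * f y)) ∧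
  (∀ f : ℝ → ℝ, ∀ t : ℝ, IsUnimodalDensity f t → ∀ x : ℝ,
    (∫ y : ℝ, s (t, y) * f y) ≤ (∫ y : ℝ, s (x, y) * f y) ∧
    ((∫ y : ℝ, s (t, y) * f y) = (∫ y : ℝ, s (x, y) * f y) → x = t))

/-- `v` is a strict `𝓕₀`-identification function for the mode. -/
def StrictF0Identification (v : ℝ × ℝ → ℝ) : Prop :=
  Measurable v ∧
  (∀ x : ℝ, ∀ f : ℝ → ℝ, MemF0 f → Integrable (fun y => |v (x, y)| * f y)) ∧
  (∀ f : ℝ → ℝ, ∀ t : ℝ, IsUnimodalDensity f t → ∀ x : ℝ,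
    (∫ y : ℝ, v (x, y) * f y) = 0 ↔ x = t)

/-- Auxiliary: unnormalised (possibly not strictly) unimodal function. -/
def WeakUni (f : ℝ → ℝ) (t : ℝ) : Prop :=
  Continuous f ∧ (∀ y, 0 ≤ f y) ∧ Integrable f ∧
    MonotoneOn f (Set.Iic t) ∧ AntitoneOn f (Set.Ici t)

lemma strict_normalize {f : ℝ → ℝ} {t : ℝ} (hf : WeakUni f t)
    (hs : ∀ x, x ≠ t → f x < f t) :
    0 < (∫ y, f y) ∧ IsUnimodalDensity (fun y => (∫ y, f y)⁻¹ * f y) t := by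
  obtain ⟨hc, h0, hi, hm, ha⟩ := hf
  have hpos : 0 < ∫ y, f y := by
    refine integral_pos_of_integrable_nonneg_nonzero (x := t) hc hi h0 ?_
    have := hs (t + 1) (by linarith)
    have := h0 (t + 1)
    linarith
  have hinv : 0 < (∫ y, f y)⁻¹ := inv_pos.mpr hpos
  refine ⟨hpos, continuous_const.mul hc, fun y => mul_nonneg hinv.le (h0 y), ?_, ?_, ?_, ?_⟩
  · rw [integral_const_mul, inv_mul_cancel₀ hpos.ne']
  · intro x hx y hy hxy
    exact mul_le_mul_of_nonneg_left (hm hx hy hxy) hinv.le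
  · intro x hx y hy hxy
    exact mul_le_mul_of_nonneg_left (ha hx hy hxy) hinv.le
  · intro x hx
    exact mul_lt_mul_of_pos_left (hs x hx) hinv

lemma strict_int {s : ℝ × ℝ → ℝ} (H : StrictlyF0Consistent s) {f : ℝ → ℝ} {t : ℝ}
    (hf : WeakUni f t) (hs : ∀ x, x ≠ t → f x < f t) (x : ℝ) :
    Integrable (fun y => s (x, y) * f y) := by
  obtain ⟨hpos, hd⟩ := strict_normalize hf hs
  have h1 := H.2.1 x _ ⟨t, hd⟩
  have h2 := h1.const_mul (∫ y, f y)
  have hsm : Measurable (fun y => s (x, y)) := H.1.comp (measurable_const.prodMk measurable_id)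
  refine h2.mono (hsm.mul hf.1.measurable).aestronglyMeasurable ?_
  refine Eventually.of_forall fun y => le_of_eq ?_
  have : (∫ y, f y) * (|s (x, y)| * ((∫ y, f y)⁻¹ * f y)) = |s (x, y)| * f y := by
    field_simp
  rw [this]
  simp [abs_mul]

lemma strict_le {s : ℝ × ℝ → ℝ} (H : StrictlyF0Consistent s) {f : ℝ → ℝ} {t : ℝ}
    (hf : WeakUni f t) (hs : ∀ x, x ≠ t → f x < f t) (x : ℝ) :
    (∫ y, s (t, y) * f y) ≤ ∫ y, s (x, y) * f y := by
  obtain ⟨hpos, hd⟩ := strict_normalize hf hs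
  have h1 := (H.2.2 _ t hd x).1
  have e : ∀ z, (∫ y, s (z, y) * ((∫ y, f y)⁻¹ * f y))
      = (∫ y, f y)⁻¹ * ∫ y, s (z, y) * f y := by
    intro z
    rw [← integral_const_mul]
    congr 1; ext y; ring
  rw [e, e] at h1
  exact le_of_mul_le_mul_left h1 (inv_pos.mpr hpos)

/-- Auxiliary Cauchy bump. -/
noncomputable def bump (t y : ℝ) : ℝ := (1 + (y - t) ^ 2)⁻¹

lemma bump_pos (t y : ℝ) : 0 < bump t y := by unfold bump; positivity

lemma bump_cont (t : ℝ) : Continuous (bump t) := by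
  unfold bump
  exact Continuous.inv₀ (by fun_prop) (fun y => by positivity)

lemma bump_weak (t : ℝ) : WeakUni (bump t) t := by
  refine ⟨bump_cont t, fun y => (bump_pos t y).le, ?_, ?_, ?_⟩
  · exact integrable_inv_one_add_sq.comp_sub_right t
  · intro x hx y hy hxy
    simp only [Set.mem_Iic] at hx hy
    unfold bump
    exact inv_anti₀ (by positivity) (by nlinarith)
  · intro x hx y hy hxy
    simp only [Set.mem_Ici] at hx hy
    unfold bump
    exact inv_anti₀ (by positivity) (by nlinarith)

lemma bump_strict (t x : ℝ) (hx : x ≠ t) : bump t x < bump t t := by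
  unfold bump
  have : 0 < (x - t) ^ 2 := by have := sub_ne_zero.mpr hx; positivity
  exact inv_strictAnti₀ (by positivity) (by simpa using this)

lemma mix_weak {g : ℝ → ℝ} {t : ℝ} (hg : WeakUni g t) {e : ℝ} (he : 0 < e) :
    WeakUni (fun y => g y + e * bump t y) t ∧
    ∀ x, x ≠ t → g x + e * bump t x < g t + e * bump t t := by
  obtain ⟨hc, h0, hi, hm, ha⟩ := hg
  obtain ⟨bc, b0, bi, bm, ba⟩ := bump_weak t
  refine ⟨⟨hc.add (continuous_const.mul bc), fun y => add_nonneg (h0 y) (mul_nonneg he.le (b0 y)),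
    hi.add (bi.const_mul e), ?_, ?_⟩, ?_⟩
  · intro x hx y hy hxy
    exact add_le_add (hm hx hy hxy) (mul_le_mul_of_nonneg_left (bm hx hy hxy) he.le)
  · intro x hx y hy hxy
    exact add_le_add (ha hx hy hxy) (mul_le_mul_of_nonneg_left (ba hx hy hxy) he.le)
  · intro x hx
    refine add_lt_add_of_le_of_lt ?_ (mul_lt_mul_of_pos_left (bump_strict t x hx) he)
    rcases le_total x t with h | h
    · exact hm h (Set.mem_Iic.mpr le_rfl) h
    · exact ha (Set.mem_Ici.mpr le_rfl) h h

lemma weak_int {s : ℝ × ℝ → ℝ} (H : StrictlyF0Consistent s) {g : ℝ → ℝ} {t : ℝ}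
    (hg : WeakUni g t) (x : ℝ) : Integrable (fun y => s (x, y) * g y) := by
  obtain ⟨h1, h2⟩ := mix_weak hg one_pos
  have h3 := (strict_int H h1 h2 x).sub (strict_int H (bump_weak t) (bump_strict t) x)
  refine h3.congr (Eventually.of_forall fun y => ?_)
  simp only [Pi.sub_apply]
  ring

lemma weak_le {s : ℝ × ℝ → ℝ} (H : StrictlyF0Consistent s) {g : ℝ → ℝ} {t : ℝ}
    (hg : WeakUni g t) (x : ℝ) :
    (∫ y, s (t, y) * g y) ≤ ∫ y, s (x, y) * g y := by
  set A := ∫ y, s (t, y) * g y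
  set B := ∫ y, s (x, y) * g y
  set C := ∫ y, s (t, y) * bump t y
  set D := ∫ y, s (x, y) * bump t y
  have key : ∀ e : ℝ, 0 < e → A + e * C ≤ B + e * D := by
    intro e he
    obtain ⟨h1, h2⟩ := mix_weak hg he
    have h3 := strict_le H h1 h2 x
    have E : ∀ z, (∫ y, s (z, y) * (g y + e * bump t y))
        = (∫ y, s (z, y) * g y) + e * ∫ y, s (z, y) * bump t y := by
      intro z
      rw [← integral_const_mul, ← integral_add (weak_int H hg z)
        ((weak_int H (bump_weak t) z).const_mul e)]
      congr 1; ext y; ring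
    rw [E, E] at h3
    exact h3
  by_contra hlt
  push Not at hlt
  have hp : 0 < A - B := by linarith
  have h := key ((A - B) / (2 * (|D - C| + 1))) (by positivity)
  have hD : D - C < |D - C| + 1 := by linarith [le_abs_self (D - C)]
  have hq : (A - B) / (2 * (|D - C| + 1)) * (|D - C| + 1) = (A - B) / 2 := by
    have : |D - C| + 1 ≠ 0 := by positivity
    field_simp
  have hr : (A - B) / (2 * (|D - C| + 1)) * (D - C)
      ≤ (A - B) / (2 * (|D - C| + 1)) * (|D - C| + 1) :=
    mul_le_mul_of_nonneg_left hD.le (by positivity)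
  rw [hq] at hr
  linarith

/-- Auxiliary trapezoid. -/
noncomputable def trap (a b : ℝ) (n : ℕ) (y : ℝ) : ℝ :=
  max 0 (1 - ((n : ℝ) + 1) * max 0 (max (a - y) (y - b)))

lemma trap_weak (a b : ℝ) (n : ℕ) {t : ℝ} (hat : a ≤ t) (htb : t ≤ b) :
    WeakUni (trap a b n) t := by
  have hc : Continuous (trap a b n) := by unfold trap; fun_prop
  refine ⟨hc, fun y => le_max_left _ _, ?_, ?_, ?_⟩
  · refine hc.integrable_of_hasCompactSupport
      (HasCompactSupport.of_support_subset_isCompact (isCompact_Icc (a := a - 1) (b := b + 1)) ?_)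
    intro y hy
    by_contra hn
    apply hy
    unfold trap
    refine max_eq_left ?_
    have h1 : 1 ≤ max 0 (max (a - y) (y - b)) := by
      simp only [Set.mem_Icc, not_and_or, not_le] at hn
      rcases hn with h | h
      · exact le_max_of_le_right (le_max_of_le_left (by linarith))
      · exact le_max_of_le_right (le_max_of_le_right (by linarith))
    have h2 : (0 : ℝ) ≤ n := Nat.cast_nonneg n
    nlinarith
  · intro x hx y hy hxy
    simp only [Set.mem_Iic] at hx hy
    unfold trap
    refine max_le_max le_rfl (sub_le_sub_left (mul_le_mul_of_nonneg_left ?_ (by positivity)) _)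
    refine max_le (le_max_left _ _) (max_le ?_ ?_)
    · exact le_max_of_le_right (le_max_of_le_left (by linarith))
    · exact le_max_of_le_left (by linarith)
  · intro x hx y hy hxy
    simp only [Set.mem_Ici] at hx hy
    unfold trap
    refine max_le_max le_rfl (sub_le_sub_left (mul_le_mul_of_nonneg_left ?_ (by positivity)) _)
    refine max_le (le_max_left _ _) (max_le ?_ ?_)
    · exact le_max_of_le_left (by linarith)
    · exact le_max_of_le_right (le_max_of_le_right (by linarith))

lemma trap_le (a b : ℝ) (n : ℕ) (y : ℝ) : trap a b n y ≤ trap a b 0 y := by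
  unfold trap
  refine max_le_max le_rfl (sub_le_sub_left (mul_le_mul_of_nonneg_right ?_ (le_max_left _ _)) _)
  have h2 : (0 : ℝ) ≤ n := Nat.cast_nonneg n
  simpa using h2

lemma trap_tendsto (a b y : ℝ) :
    Tendsto (fun n => trap a b n y) atTop (nhds ((Set.Icc a b).indicator (fun _ => (1 : ℝ)) y)) := by
  by_cases hy : y ∈ Set.Icc a b
  · rw [Set.indicator_of_mem hy]
    have : ∀ n, trap a b n y = 1 := by
      intro n
      have : max 0 (max (a - y) (y - b)) = 0 :=
        max_eq_left (max_le (by linarith [hy.1]) (by linarith [hy.2]))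
      unfold trap
      rw [this]; simp
    simp [this]
  · rw [Set.indicator_of_notMem hy]
    have hpos : 0 < max 0 (max (a - y) (y - b)) := by
      simp only [Set.mem_Icc, not_and_or, not_le] at hy
      rcases hy with h | h
      · exact lt_max_of_lt_right (lt_max_of_lt_left (by linarith))
      · exact lt_max_of_lt_right (lt_max_of_lt_right (by linarith))
    obtain ⟨N, hN⟩ := exists_nat_gt (1 / max 0 (max (a - y) (y - b)))
    refine tendsto_const_nhds.congr' ?_
    filter_upwards [eventually_ge_atTop N] with n hn
    unfold trap
    symm
    refine max_eq_left ?_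
    rw [div_lt_iff₀ hpos] at hN
    have : (N : ℝ) ≤ n := Nat.cast_le.mpr hn
    nlinarith

lemma loc_int {s : ℝ × ℝ → ℝ} (H : StrictlyF0Consistent s) (x : ℝ) :
    LocallyIntegrable (fun y => s (x, y)) := by
  rw [locallyIntegrable_iff]
  intro k hk
  have h1 := (weak_int H (bump_weak 0) x).integrableOn (s := k)
  have h2 : IntegrableOn (fun y => s (x, y) * bump 0 y * (bump 0 y)⁻¹) k :=
    h1.mul_continuousOn ((bump_cont 0).inv₀ (fun y => (bump_pos 0 y).ne')).continuousOn hk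
  refine h2.congr (Eventually.of_forall fun y => ?_)
  have := (bump_pos 0 y).ne'
  field_simp

lemma plateau {s : ℝ × ℝ → ℝ} (H : StrictlyF0Consistent s) {a b x z : ℝ}
    (hax : a ≤ x) (hxb : x ≤ b) (haz : a ≤ z) (hzb : z ≤ b) :
    (∫ y in a..b, s (x, y)) = ∫ y in a..b, s (z, y) := by
  have lim : ∀ w, Tendsto (fun n => ∫ y, s (w, y) * trap a b n y) atTop
      (nhds (∫ y in a..b, s (w, y))) := by
    intro w
    have e : (∫ y in a..b, s (w, y))
        = ∫ y, s (w, y) * (Set.Icc a b).indicator (fun _ => (1 : ℝ)) y := by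
      rw [intervalIntegral.integral_of_le (hax.trans hxb), ← integral_Icc_eq_integral_Ioc,
        ← integral_indicator measurableSet_Icc]
      congr 1; ext y
      by_cases hy : y ∈ Set.Icc a b
      · simp [Set.indicator_of_mem hy]
      · simp [Set.indicator_of_notMem hy]
    rw [e]
    refine tendsto_integral_of_dominated_convergence (fun y => ‖s (w, y) * trap a b 0 y‖)
      (fun n => (weak_int H (trap_weak a b n hax hxb) w).aestronglyMeasurable)
      (weak_int H (trap_weak a b 0 hax hxb) w).norm ?_ ?_
    · intro n
      refine Eventually.of_forall fun y => ?_
      rw [norm_mul, norm_mul]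
      refine mul_le_mul_of_nonneg_left ?_ (norm_nonneg _)
      rw [Real.norm_of_nonneg ((trap_weak a b n hax hxb).2.1 y),
        Real.norm_of_nonneg ((trap_weak a b 0 hax hxb).2.1 y)]
      exact trap_le a b n y
    · exact Eventually.of_forall fun y => (trap_tendsto a b y).const_mul _
  refine tendsto_nhds_unique (lim x) ((lim z).congr fun n => ?_)
  exact le_antisymm (weak_le H (trap_weak a b n haz hzb) x) (weak_le H (trap_weak a b n hax hxb) z)

/-- The mode is not elicitable relative to the class 𝓕₀ of strictly unimodal
distributions with continuous Lebesgue density. -/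
theorem mode_not_elicitable_F0 :
    ¬ ∃ s : ℝ × ℝ → ℝ, StrictlyF0Consistent s := by
  rintro ⟨s, H⟩
  have ii : ∀ x a b, IntervalIntegrable (fun y => s (x, y)) volume a b := fun x a b =>
    intervalIntegrable_iff.mpr <|
      ((loc_int H x).integrableOn_isCompact isCompact_uIcc).mono_set uIoc_subset_uIcc
  have hadd : ∀ x a b c, (∫ y in a..b, s (x, y)) + (∫ y in b..c, s (x, y))
      = ∫ y in a..c, s (x, y) := fun x a b c =>
    intervalIntegral.integral_add_adjacent_intervals (ii x a b) (ii x b c)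
  have key : ∀ u, (∫ y in (0 : ℝ)..u, s (0, y)) = ∫ y in (0 : ℝ)..u, s (1, y) := by
    intro u
    have p01 : (∫ y in (0 : ℝ)..1, s (0, y)) = ∫ y in (0 : ℝ)..1, s (1, y) :=
      plateau H le_rfl zero_le_one zero_le_one le_rfl
    rcases le_total u 0 with h | h
    · have p : (∫ y in u..1, s (0, y)) = ∫ y in u..1, s (1, y) :=
        plateau H h zero_le_one (h.trans zero_le_one) le_rfl
      have a0 := hadd 0 0 u 1
      have a1 := hadd 1 0 u 1
      linarith
    rcases le_total 1 u with h1 | h1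
    · exact plateau H le_rfl h zero_le_one h1
    · have p1 : (∫ y in (0 : ℝ)..u, s (0, y)) = ∫ y in (0 : ℝ)..u, s (u, y) :=
        plateau H le_rfl h h le_rfl
      have p2 : (∫ y in u..1, s (u, y)) = ∫ y in u..1, s (1, y) :=
        plateau H le_rfl h1 h1 le_rfl
      have p3 : (∫ y in (0 : ℝ)..1, s (u, y)) = ∫ y in (0 : ℝ)..1, s (1, y) :=
        plateau H h h1 zero_le_one le_rfl
      have a0 := hadd u 0 u 1
      have a1 := hadd 1 0 u 1
      linarith
  have hae : ∀ᵐ y, s (0, y) = s (1, y) := by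
    filter_upwards [_root_.LocallyIntegrable.ae_hasDerivAt_integral (loc_int H 0),
      _root_.LocallyIntegrable.ae_hasDerivAt_integral (loc_int H 1)]
      with y h0 h1
    have h0 := h0 0
    rw [funext key] at h0
    exact h0.unique (h1 0)
  obtain ⟨-, hd⟩ := strict_normalize (bump_weak 0) (bump_strict 0)
  have h := (H.2.2 _ 0 hd 1).2 (integral_congr_ae (by
    filter_upwards [hae] with y hy
    rw [hy]))
  exact one_ne_zero h
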